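/- Let f̄ ≥ 0 and let φ : ℝ^n → ℝ be Lebesgue-measurable with |φ(z)| ≤ f̄ for all z, and let ξ > 0. Then the Gaussian smoothing φ_ξ has Lipschitz-continuous gradient with constant f̄/ξ²: for all x, x' ∈ ℝ^n, ‖∇φ_ξ(x) − ∇φ_ξ(x')‖ ≤ (f̄/ξ²) ‖x − x'‖. -/

import Mathlib

open MeasureTheory

/-- The Gaussian kernel `h_ξ(z) = (2πξ²)^{-n/2} exp(-‖z‖²/(2ξ²))` on `ℝⁿ`. -/
noncomputable def gaussKernel (n : ℕ) (ξ : ℝ) (z : EuclideanSpace ℝ (Fin n)) : ℝ :=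
  (2 * Real.pi * ξ ^ 2) ^ (-(n : ℝ) / 2) * Real.exp (-‖z‖ ^ 2 / (2 * ξ ^ 2))

/-- The Gaussian smoothing `φ_ξ(x) = ∫ h_ξ(x - z) φ(z) dz`. -/
noncomputable def gaussSmooth (n : ℕ) (ξ : ℝ) (φ : EuclideanSpace ℝ (Fin n) → ℝ)
    (x : EuclideanSpace ℝ (Fin n)) : ℝ :=
  ∫ z, gaussKernel n ξ (x - z) * φ z

lemma lintegral_enorm_sq_sub_one_gaussianReal_le :
    ∫⁻ s, ‖s ^ 2 - 1‖ₑ ∂(ProbabilityTheory.gaussianReal 0 1) ≤ 1 := by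
  set γ := ProbabilityTheory.gaussianReal 0 1
  have hsq : Integrable (fun s : ℝ => s ^ 2) γ :=
    (ProbabilityTheory.memLp_id_gaussianReal 2).integrable_sq
  have hint : Integrable (fun s : ℝ => s ^ 2 - 1) γ := hsq.sub (integrable_const _)
  have hvar : ∫ s, s ^ 2 ∂γ = 1 := by
    have h := ProbabilityTheory.variance_id_gaussianReal (μ := 0) (v := 1)
    rw [ProbabilityTheory.variance_eq_integral aemeasurable_id] at h
    simpa [ProbabilityTheory.integral_id_gaussianReal] using h
  have hzero : ∫ s, (s ^ 2 - 1) ∂γ = 0 := by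
    rw [integral_sub hsq (integrable_const _), hvar]; simp [γ]
  have habs : ∀ s : ℝ, ‖s ^ 2 - 1‖ =
      (s ^ 2 - 1) - 2 * (Set.Ioc (-1 : ℝ) 1).indicator (fun s => s ^ 2 - 1) s := by
    intro s
    by_cases hs : s ∈ Set.Ioc (-1 : ℝ) 1
    · rw [Set.indicator_of_mem hs, Real.norm_of_nonpos (by nlinarith [hs.1, hs.2])]; ring
    · rw [Set.indicator_of_notMem hs, Real.norm_of_nonneg]
      · ring
      · rw [Set.mem_Ioc, not_and_or, not_lt, not_le] at hs
        rcases hs with hs | hs <;> nlinarith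
  have hset : ∫ s in Set.Ioc (-1 : ℝ) 1, (s ^ 2 - 1) ∂γ
      = -(2 * (√(2 * Real.pi))⁻¹ * Real.exp (-1 / 2)) := by
    rw [← integral_indicator measurableSet_Ioc,
      ProbabilityTheory.integral_gaussianReal_eq_integral_smul one_ne_zero]
    have : (fun x => ProbabilityTheory.gaussianPDFReal 0 1 x •
        (Set.Ioc (-1 : ℝ) 1).indicator (fun s => s ^ 2 - 1) x) =
        (Set.Ioc (-1 : ℝ) 1).indicator (fun s =>
          (√(2 * Real.pi))⁻¹ * ((s ^ 2 - 1) * Real.exp (-s ^ 2 / 2))) := by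
      ext s
      by_cases hs : s ∈ Set.Ioc (-1 : ℝ) 1
      · simp only [Set.indicator_of_mem hs, ProbabilityTheory.gaussianPDFReal_def, smul_eq_mul,
          NNReal.coe_one, mul_one, sub_zero]
        ring
      · simp [Set.indicator_of_notMem hs]
    rw [this, integral_indicator measurableSet_Ioc, integral_const_mul,
      ← intervalIntegral.integral_of_le (by norm_num),
      intervalIntegral.integral_eq_sub_of_hasDerivAt
        (f := fun s => -(s * Real.exp (-s ^ 2 / 2)))]
    · norm_num
      ring
    · intro s _
      have h1 : HasDerivAt (fun s : ℝ => -s ^ 2 / 2) (-s) s := by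
        convert! ((hasDerivAt_pow 2 s).neg.div_const 2) using 1
        simp; ring
      convert! ((hasDerivAt_id s).mul h1.exp).neg using 1
      simp; ring
    · exact (by fun_prop : Continuous _).intervalIntegrable _ _
  have hval : ∫ s, ‖s ^ 2 - 1‖ ∂γ ≤ 1 := by
    simp_rw [habs]
    rw [integral_sub hint ((hint.indicator measurableSet_Ioc).const_mul 2), hzero,
      integral_const_mul, integral_indicator measurableSet_Ioc, hset]
    have hπ := Real.pi_gt_d2
    have he := Real.exp_one_gt_d9
    have hsqrt : 4 * Real.exp (-1 / 2) ≤ √(2 * Real.pi) := by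
      apply Real.le_sqrt_of_sq_le
      have h2 : Real.exp (-1 / 2) ^ 2 * Real.exp 1 = 1 := by
        rw [← Real.exp_nat_mul, ← Real.exp_add]; norm_num
      have h3 : 0 < Real.exp (-1 / 2) ^ 2 := by positivity
      nlinarith
    have hpos : 0 < √(2 * Real.pi) := by positivity
    have : (√(2 * Real.pi))⁻¹ * (4 * Real.exp (-1 / 2)) ≤ 1 := by
      rw [inv_mul_le_iff₀ hpos]; linarith
    linarith
  rw [← ofReal_integral_norm_eq_lintegral_enorm hint]
  exact ENNReal.ofReal_le_one.2 hval

lemma integrable_exp_neg_mul_sq_norm {V : Type*} [NormedAddCommGroup V] [InnerProductSpace ℝ V]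
    [FiniteDimensional ℝ V] [MeasurableSpace V] [BorelSpace V] {b : ℝ} (hb : 0 < b) :
    Integrable (fun v : V => Real.exp (-b * ‖v‖ ^ 2)) := by
  apply Integrable.of_integral_ne_zero
  rw [GaussianFourier.integral_rexp_neg_mul_sq_norm hb]
  positivity

lemma gaussKernel_pos (n : ℕ) {ξ : ℝ} (hξ : 0 < ξ) (z : EuclideanSpace ℝ (Fin n)) :
    0 < gaussKernel n ξ z := by
  unfold gaussKernel
  positivity

lemma continuous_gaussKernel (n : ℕ) (ξ : ℝ) : Continuous (gaussKernel n ξ) := by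
  unfold gaussKernel
  fun_prop

lemma integrable_gaussKernel (n : ℕ) {ξ : ℝ} (hξ : 0 < ξ) : Integrable (gaussKernel n ξ) := by
  have h := (integrable_exp_neg_mul_sq_norm (V := EuclideanSpace ℝ (Fin n))
    (b := 1 / (2 * ξ ^ 2)) (by positivity)).const_mul ((2 * Real.pi * ξ ^ 2) ^ (-(n : ℝ) / 2))
  refine h.congr (ae_of_all _ fun z => ?_)
  simp only [gaussKernel]
  congr 2
  ring

/-- The measure on `ℝⁿ` with density `gaussKernel n ξ`. -/
noncomputable def gaussMeasure (n : ℕ) (ξ : ℝ) : Measure (EuclideanSpace ℝ (Fin n)) :=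
  volume.withDensity fun z => ENNReal.ofReal (gaussKernel n ξ z)

lemma isFiniteMeasure_gaussMeasure (n : ℕ) {ξ : ℝ} (hξ : 0 < ξ) :
    IsFiniteMeasure (gaussMeasure n ξ) :=
  isFiniteMeasure_withDensity_ofReal (integrable_gaussKernel n hξ).2

lemma gaussMeasure_map_inner (n : ℕ) {ξ : ℝ} (hξ : 0 < ξ) (a : EuclideanSpace ℝ (Fin n)) :
    (gaussMeasure n ξ).map (fun y => inner ℝ a y / ξ) =
      (ProbabilityTheory.gaussianReal 0 1).map (‖a‖ * ·) := by
  have := isFiniteMeasure_gaussMeasure n hξ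
  rw [ProbabilityTheory.gaussianReal_map_const_mul]
  apply Measure.ext_of_charFun
  ext t
  rw [ProbabilityTheory.charFun_gaussianReal, charFun_apply,
    integral_map (by fun_prop) (by fun_prop), gaussMeasure,
    integral_withDensity_eq_integral_toReal_smul
      (continuous_gaussKernel n ξ).measurable.ennreal_ofReal (by simp)]
  have hb : 0 < ((1 / (2 * ξ ^ 2) : ℝ) : ℂ).re := by
    rw [Complex.ofReal_re]; positivity
  have hξ' : (ξ : ℂ) ≠ 0 := by exact_mod_cast hξ.ne'
  have key := GaussianFourier.integral_cexp_neg_mul_sq_norm_add hb (t / ξ * Complex.I) a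
  have hpt : ∀ y : EuclideanSpace ℝ (Fin n),
      (ENNReal.ofReal (gaussKernel n ξ y)).toReal •
        Complex.exp ((inner ℝ (inner ℝ a y / ξ) t : ℝ) * Complex.I) =
      ((2 * Real.pi * ξ ^ 2) ^ (-(n : ℝ) / 2) : ℝ) *
        Complex.exp (-((1 / (2 * ξ ^ 2) : ℝ) : ℂ) * ‖y‖ ^ 2 +
          t / ξ * Complex.I * (inner ℝ a y : ℝ)) := by
    intro y
    rw [ENNReal.toReal_ofReal (gaussKernel_pos n hξ y).le, gaussKernel, Complex.real_smul,
      Complex.exp_add, Complex.ofReal_mul, Complex.ofReal_exp, mul_assoc]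
    congr 3
    · push_cast; field_simp
    · simp only [RCLike.inner_apply, conj_trivial]
      push_cast; field_simp
  simp_rw [hpt]
  rw [integral_const_mul, key, ← mul_assoc]
  have hconst : ((((2 * Real.pi * ξ ^ 2) ^ (-(n : ℝ) / 2) : ℝ)) : ℂ) *
      ((Real.pi : ℂ) / ((1 / (2 * ξ ^ 2) : ℝ) : ℂ)) ^
        ((Module.finrank ℝ (EuclideanSpace ℝ (Fin n)) : ℂ) / 2) = 1 := by
    have h1 : (Real.pi : ℂ) / ((1 / (2 * ξ ^ 2) : ℝ) : ℂ) = ((2 * Real.pi * ξ ^ 2 : ℝ) : ℂ) := by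
      push_cast; field_simp
    have h2 : ((Module.finrank ℝ (EuclideanSpace ℝ (Fin n)) : ℂ) / 2) = (((n : ℝ) / 2 : ℝ) : ℂ) := by
      simp
    rw [h1, h2, ← Complex.ofReal_cpow (by positivity), ← Complex.ofReal_mul,
      ← Real.rpow_add (by positivity), neg_div, neg_add_cancel, Real.rpow_zero, Complex.ofReal_one]
  rw [hconst, one_mul]
  congr 1
  simp only [NNReal.coe_mul, NNReal.coe_mk, NNReal.coe_one]
  push_cast
  field_simp
  simp only [Complex.I_sq]
  ring

lemma lintegral_enorm_inner_sq_sub_le (n : ℕ) {ξ : ℝ} (hξ : 0 < ξ)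
    (a : EuclideanSpace ℝ (Fin n)) :
    ∫⁻ y, ‖(inner ℝ a y / ξ) ^ 2 - ‖a‖ ^ 2‖ₑ ∂(gaussMeasure n ξ) ≤ ENNReal.ofReal (‖a‖ ^ 2) := by
  rw [← lintegral_map (f := fun s : ℝ => ‖s ^ 2 - ‖a‖ ^ 2‖ₑ) (g := fun y => inner ℝ a y / ξ)
    (by fun_prop) (by fun_prop), gaussMeasure_map_inner n hξ,
    lintegral_map (by fun_prop) (by fun_prop)]
  have h : ∀ s : ℝ, ‖(‖a‖ * s) ^ 2 - ‖a‖ ^ 2‖ₑ = ENNReal.ofReal (‖a‖ ^ 2) * ‖s ^ 2 - 1‖ₑ := by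
    intro s
    rw [← Real.enorm_of_nonneg (sq_nonneg ‖a‖), ← enorm_mul]
    congr 1; ring
  simp_rw [h]
  rw [lintegral_const_mul _ (by fun_prop)]
  exact mul_le_of_le_one_right' lintegral_enorm_sq_sub_one_gaussianReal_le

lemma lintegral_enorm_inner_mul_inner_sub_le (n : ℕ) {ξ : ℝ} (hξ : 0 < ξ)
    (u v : EuclideanSpace ℝ (Fin n)) :
    ∫⁻ y, ‖inner ℝ u y * inner ℝ v y / ξ ^ 2 - inner ℝ u v‖ₑ ∂(gaussMeasure n ξ) ≤
      ENNReal.ofReal (‖u‖ * ‖v‖) := by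
  rcases eq_or_ne u 0 with rfl | hu
  · simp
  rcases eq_or_ne v 0 with rfl | hv
  · simp
  have hu' : 0 < ‖u‖ := norm_pos_iff.2 hu
  have hv' : 0 < ‖v‖ := norm_pos_iff.2 hv
  set c : ℝ := ‖u‖ * ‖v‖ with hc
  have hc0 : 0 < c := by positivity
  set a : EuclideanSpace ℝ (Fin n) := (2⁻¹ : ℝ) • (‖v‖ • u + ‖u‖ • v)
  set b : EuclideanSpace ℝ (Fin n) := (2⁻¹ : ℝ) • (‖v‖ • u - ‖u‖ • v)
  have ha : ‖a‖ ^ 2 = (c ^ 2 + c * inner ℝ u v) / 2 := by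
    simp only [a, norm_smul, mul_pow, norm_add_sq_real, inner_smul_left, inner_smul_right,
      norm_norm, conj_trivial]
    norm_num
    rw [hc]; ring
  have hb : ‖b‖ ^ 2 = (c ^ 2 - c * inner ℝ u v) / 2 := by
    simp only [b, norm_smul, mul_pow, norm_sub_sq_real, inner_smul_left, inner_smul_right,
      norm_norm, conj_trivial]
    norm_num
    rw [hc]; ring
  have hpt : ∀ y, ENNReal.ofReal c * ‖inner ℝ u y * inner ℝ v y / ξ ^ 2 - inner ℝ u v‖ₑ ≤
      ‖(inner ℝ a y / ξ) ^ 2 - ‖a‖ ^ 2‖ₑ + ‖(inner ℝ b y / ξ) ^ 2 - ‖b‖ ^ 2‖ₑ := by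
    intro y
    rw [← Real.enorm_of_nonneg hc0.le, ← enorm_mul]
    refine le_trans (le_of_eq ?_) (enorm_sub_le (a := (inner ℝ a y / ξ) ^ 2 - ‖a‖ ^ 2))
    congr 1
    rw [ha, hb]
    simp only [a, b, inner_smul_left, inner_add_left, inner_sub_left, conj_trivial]
    rw [hc]; ring
  have hmul : ENNReal.ofReal c *
      ∫⁻ y, ‖inner ℝ u y * inner ℝ v y / ξ ^ 2 - inner ℝ u v‖ₑ ∂(gaussMeasure n ξ) ≤
      ENNReal.ofReal c * ENNReal.ofReal c := by
    rw [← lintegral_const_mul _ (by fun_prop)]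
    refine (lintegral_mono hpt).trans ?_
    rw [lintegral_add_left (by fun_prop)]
    refine (add_le_add (lintegral_enorm_inner_sq_sub_le n hξ a)
      (lintegral_enorm_inner_sq_sub_le n hξ b)).trans ?_
    rw [← ENNReal.ofReal_add (by positivity) (by positivity), ← ENNReal.ofReal_mul hc0.le]
    apply ENNReal.ofReal_le_ofReal
    rw [ha, hb]
    exact le_of_eq (by ring)
  exact (ENNReal.mul_le_mul_iff_right (by simpa using hc0) ENNReal.ofReal_ne_top).1 hmul

lemma hasFDerivAt_gaussKernel (n : ℕ) {ξ : ℝ} (hξ : 0 < ξ) (y : EuclideanSpace ℝ (Fin n)) :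
    HasFDerivAt (gaussKernel n ξ) (-(gaussKernel n ξ y / ξ ^ 2) • innerSL ℝ y) y := by
  have h1 : HasFDerivAt (fun z : EuclideanSpace ℝ (Fin n) => -‖z‖ ^ 2 / (2 * ξ ^ 2))
      (-(1 / ξ ^ 2) • innerSL ℝ y) y := by
    convert! ((hasStrictFDerivAt_norm_sq y).hasFDerivAt.const_mul (-(1 / (2 * ξ ^ 2)))) using 1
    · ext z; ring
    · ext v
      simp
      field_simp
  convert! (h1.exp.const_mul ((2 * Real.pi * ξ ^ 2) ^ (-(n : ℝ) / 2))) using 1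
  ext v
  simp [gaussKernel]
  ring

/-- Up to a constant, a wider Gaussian dominates the derivative of the Gaussian kernel, uniformly
under translations by at most `1`. -/
lemma exists_gaussKernel_mul_norm_le (n : ℕ) {ξ : ℝ} (hξ : 0 < ξ) :
    ∃ C : ℝ, 0 ≤ C ∧ ∀ y w : EuclideanSpace ℝ (Fin n), ‖w - y‖ ≤ 1 →
      gaussKernel n ξ y * ‖y‖ ≤ C * Real.exp (-(1 / (8 * ξ ^ 2)) * ‖w‖ ^ 2) := by
  refine ⟨(2 * Real.pi * ξ ^ 2) ^ (-(n : ℝ) / 2) * (2 * ξ * Real.exp (1 / (4 * ξ ^ 2))),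
    by positivity, fun y w hwy => ?_⟩
  have h1 : ‖y‖ ≤ 2 * ξ * Real.exp (‖y‖ ^ 2 / (4 * ξ ^ 2)) := by
    have h := Real.add_one_le_exp (‖y‖ ^ 2 / (4 * ξ ^ 2))
    have h2 : ‖y‖ / (2 * ξ) ≤ ‖y‖ ^ 2 / (4 * ξ ^ 2) + 1 := by
      have h3 : ‖y‖ ^ 2 / (4 * ξ ^ 2) = (‖y‖ / (2 * ξ)) ^ 2 := by ring
      rw [h3]
      nlinarith [sq_nonneg (‖y‖ / (2 * ξ) - 1), sq_nonneg (‖y‖ / (2 * ξ))]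
    have h4 := h2.trans h
    rw [div_le_iff₀ (by positivity)] at h4
    linarith
  have h2 : ‖w‖ ^ 2 ≤ 2 * ‖y‖ ^ 2 + 2 := by
    have h3 : ‖w‖ ≤ ‖y‖ + 1 := by
      have := norm_add_le (w - y) y
      rw [sub_add_cancel] at this
      linarith
    nlinarith [norm_nonneg w, norm_nonneg y, sq_nonneg (‖y‖ - 1)]
  have h3 : Real.exp (-‖y‖ ^ 2 / (2 * ξ ^ 2)) * Real.exp (‖y‖ ^ 2 / (4 * ξ ^ 2)) ≤
      Real.exp (1 / (4 * ξ ^ 2)) * Real.exp (-(1 / (8 * ξ ^ 2)) * ‖w‖ ^ 2) := by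
    rw [← Real.exp_add, ← Real.exp_add]
    apply Real.exp_le_exp.2
    have h4 : 0 ≤ (2 * ‖y‖ ^ 2 + 2 - ‖w‖ ^ 2) / (8 * ξ ^ 2) :=
      div_nonneg (by linarith) (by positivity)
    have h5 : 1 / (4 * ξ ^ 2) + -(1 / (8 * ξ ^ 2)) * ‖w‖ ^ 2 -
        (-‖y‖ ^ 2 / (2 * ξ ^ 2) + ‖y‖ ^ 2 / (4 * ξ ^ 2)) =
        (2 * ‖y‖ ^ 2 + 2 - ‖w‖ ^ 2) / (8 * ξ ^ 2) := by
      field_simp; ring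
    linarith
  unfold gaussKernel
  calc _ ≤ (2 * Real.pi * ξ ^ 2) ^ (-(n : ℝ) / 2) * Real.exp (-‖y‖ ^ 2 / (2 * ξ ^ 2)) *
        (2 * ξ * Real.exp (‖y‖ ^ 2 / (4 * ξ ^ 2))) := by gcongr
    _ = (2 * Real.pi * ξ ^ 2) ^ (-(n : ℝ) / 2) * (2 * ξ) *
        (Real.exp (-‖y‖ ^ 2 / (2 * ξ ^ 2)) * Real.exp (‖y‖ ^ 2 / (4 * ξ ^ 2))) := by ring
    _ ≤ (2 * Real.pi * ξ ^ 2) ^ (-(n : ℝ) / 2) * (2 * ξ) *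
        (Real.exp (1 / (4 * ξ ^ 2)) * Real.exp (-(1 / (8 * ξ ^ 2)) * ‖w‖ ^ 2)) := by gcongr
    _ = _ := by ring

lemma hasFDerivAt_gaussSmooth (n : ℕ) {fbar : ℝ} (hfbar : 0 ≤ fbar)
    {φ : EuclideanSpace ℝ (Fin n) → ℝ} (hmeas : Measurable φ) (hbdd : ∀ z, |φ z| ≤ fbar)
    {ξ : ℝ} (hξ : 0 < ξ) (x : EuclideanSpace ℝ (Fin n)) :
    Integrable (fun z => φ z • -(gaussKernel n ξ (x - z) / ξ ^ 2) • innerSL ℝ (x - z)) ∧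
    HasFDerivAt (gaussSmooth n ξ φ)
      (∫ z, φ z • -(gaussKernel n ξ (x - z) / ξ ^ 2) • innerSL ℝ (x - z)) x := by
  obtain ⟨C, hC, hle⟩ := exists_gaussKernel_mul_norm_le n hξ
  have hcont := continuous_gaussKernel n ξ
  have hF'_meas : AEStronglyMeasurable
      (fun z => φ z • -(gaussKernel n ξ (x - z) / ξ ^ 2) • innerSL ℝ (x - z)) := by
    refine hmeas.aestronglyMeasurable.smul (Continuous.aestronglyMeasurable ?_)
    exact ((hcont.comp (continuous_const.sub continuous_id)).div_const _).neg.smul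
      ((innerSL ℝ).continuous.comp (continuous_const.sub continuous_id))
  have hbound : ∀ z, ∀ x' ∈ Metric.ball x 1,
      ‖φ z • -(gaussKernel n ξ (x' - z) / ξ ^ 2) • innerSL ℝ (x' - z)‖ ≤
        fbar / ξ ^ 2 * (C * Real.exp (-(1 / (8 * ξ ^ 2)) * ‖x - z‖ ^ 2)) := by
    intro z x' hx'
    have h := hle (x' - z) (x - z) (by
      rw [sub_sub_sub_cancel_right, ← dist_eq_norm, dist_comm]
      exact (Metric.mem_ball.1 hx').le)
    rw [norm_smul, norm_smul, norm_neg, innerSL_apply_norm, Real.norm_eq_abs,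
      Real.norm_of_nonneg (div_nonneg (gaussKernel_pos n hξ _).le (sq_nonneg ξ))]
    calc _ = |φ z| / ξ ^ 2 * (gaussKernel n ξ (x' - z) * ‖x' - z‖) := by ring
      _ ≤ _ := by
        gcongr
        · exact mul_nonneg (gaussKernel_pos n hξ _).le (norm_nonneg _)
        · exact hbdd z
  have hbound_int : Integrable (fun z : EuclideanSpace ℝ (Fin n) =>
      fbar / ξ ^ 2 * (C * Real.exp (-(1 / (8 * ξ ^ 2)) * ‖x - z‖ ^ 2))) :=
    (((integrable_exp_neg_mul_sq_norm (by positivity)).comp_sub_left x).const_mul C).const_mul _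
  have hF_meas : ∀ x', AEStronglyMeasurable (fun z => gaussKernel n ξ (x' - z) * φ z) := fun x' =>
    (hcont.comp (continuous_const.sub continuous_id)).aestronglyMeasurable.mul
      hmeas.aestronglyMeasurable
  refine ⟨hbound_int.mono' hF'_meas (ae_of_all _ fun z => hbound z x (Metric.mem_ball_self one_pos)),
    hasFDerivAt_integral_of_dominated_of_fderiv_le (Metric.ball_mem_nhds x one_pos)
      (Filter.Eventually.of_forall hF_meas) ?_ hF'_meas (ae_of_all _ hbound) hbound_int
      (ae_of_all _ fun z x' _ => ?_)⟩
  · exact ((integrable_gaussKernel n hξ).comp_sub_left x).mul_bdd hmeas.aestronglyMeasurable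
      (ae_of_all _ hbdd)
  · exact ((hasFDerivAt_gaussKernel n hξ (x' - z)).comp x'
      ((hasFDerivAt_id x').sub_const z)).mul_const (φ z)

lemma gradient_gaussSmooth_inner (n : ℕ) {fbar : ℝ} (hfbar : 0 ≤ fbar)
    {φ : EuclideanSpace ℝ (Fin n) → ℝ} (hmeas : Measurable φ) (hbdd : ∀ z, |φ z| ≤ fbar)
    {ξ : ℝ} (hξ : 0 < ξ) (x u : EuclideanSpace ℝ (Fin n)) :
    Integrable (fun z => φ z * (inner ℝ u (x - z) * gaussKernel n ξ (x - z) / ξ ^ 2)) ∧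
    inner ℝ (gradient (gaussSmooth n ξ φ) x) u =
      -∫ z, φ z * (inner ℝ u (x - z) * gaussKernel n ξ (x - z) / ξ ^ 2) := by
  obtain ⟨hint, hder⟩ := hasFDerivAt_gaussSmooth n hfbar hmeas hbdd hξ x
  have hpt : ∀ z, φ z * (inner ℝ u (x - z) * gaussKernel n ξ (x - z) / ξ ^ 2) =
      -((φ z • -(gaussKernel n ξ (x - z) / ξ ^ 2) • innerSL ℝ (x - z)) u) := by
    intro z
    rw [real_inner_comm]
    simp only [smul_apply, innerSL_apply_apply, smul_eq_mul]
    ring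
  simp_rw [hpt]
  refine ⟨(hint.apply_continuousLinearMap u).neg, ?_⟩
  rw [integral_neg, neg_neg, ← ContinuousLinearMap.integral_apply hint, gradient,
    InnerProductSpace.toDual_symm_apply, hder.fderiv]

lemma hasFDerivAt_inner_mul_gaussKernel (n : ℕ) {ξ : ℝ} (hξ : 0 < ξ)
    (u y : EuclideanSpace ℝ (Fin n)) :
    HasFDerivAt (fun y => inner ℝ u y * gaussKernel n ξ y / ξ ^ 2)
      ((gaussKernel n ξ y / ξ ^ 2) • (innerSL ℝ u - (inner ℝ u y / ξ ^ 2) • innerSL ℝ y)) y := by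
  convert! (((innerSL ℝ u).hasFDerivAt (x := y)).mul
    (hasFDerivAt_gaussKernel n hξ y)).mul_const (ξ ^ 2)⁻¹ using 1
  ext v
  simp
  ring

lemma lintegral_enorm_inner_mul_gaussKernel_sub_le (n : ℕ) {ξ : ℝ} (hξ : 0 < ξ)
    (u d x : EuclideanSpace ℝ (Fin n)) :
    ∫⁻ z, ‖inner ℝ u (x + d - z) * gaussKernel n ξ (x + d - z) / ξ ^ 2 -
        inner ℝ u (x - z) * gaussKernel n ξ (x - z) / ξ ^ 2‖ₑ ≤
      ENNReal.ofReal (‖u‖ * ‖d‖ / ξ ^ 2) := by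
  have hcont := continuous_gaussKernel n ξ
  set g' : EuclideanSpace ℝ (Fin n) → ℝ := fun y =>
    gaussKernel n ξ y / ξ ^ 2 * (inner ℝ u d - inner ℝ u y / ξ ^ 2 * inner ℝ y d) with hg'
  have hg'_cont : Continuous g' := by fun_prop
  have hline : ∀ z, ‖inner ℝ u (x + d - z) * gaussKernel n ξ (x + d - z) / ξ ^ 2 -
      inner ℝ u (x - z) * gaussKernel n ξ (x - z) / ξ ^ 2‖ₑ ≤
      ∫⁻ t in Set.Ioc (0 : ℝ) 1, ‖g' (x + t • d - z)‖ₑ := by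
    intro z
    have h := intervalIntegral.integral_eq_sub_of_hasDerivAt (a := 0) (b := 1)
      (f := fun t : ℝ => inner ℝ u (x + t • d - z) * gaussKernel n ξ (x + t • d - z) / ξ ^ 2)
      (f' := fun t => g' (x + t • d - z))
      (fun t _ => by
        have hd : HasDerivAt (fun t : ℝ => x + t • d - z) d t := by
          simpa using (((hasDerivAt_id t).smul_const d).const_add x).sub_const z
        exact
          (hasFDerivAt_inner_mul_gaussKernel n hξ u (x + t • d - z)).comp_hasDerivAt t hd)
      ((by fun_prop : Continuous _).intervalIntegrable _ _)
    simp only [one_smul, zero_smul, add_zero] at h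
    rw [← h, intervalIntegral.integral_of_le zero_le_one]
    exact enorm_integral_le_lintegral_enorm _
  have hL1 : ∫⁻ y, ‖g' y‖ₑ ≤ ENNReal.ofReal (‖u‖ * ‖d‖ / ξ ^ 2) := by
    have h := lintegral_enorm_inner_mul_inner_sub_le n hξ u d
    rw [gaussMeasure, lintegral_withDensity_eq_lintegral_mul _
      hcont.measurable.ennreal_ofReal (by fun_prop)] at h
    have hpt : ∀ y, ‖g' y‖ₑ = ENNReal.ofReal (1 / ξ ^ 2) *
        (ENNReal.ofReal (gaussKernel n ξ y) *
          ‖inner ℝ u y * inner ℝ d y / ξ ^ 2 - inner ℝ u d‖ₑ) := by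
      intro y
      rw [← Real.enorm_of_nonneg (gaussKernel_pos n hξ y).le,
        ← Real.enorm_of_nonneg (by positivity : (0 : ℝ) ≤ 1 / ξ ^ 2), ← enorm_mul, ← enorm_mul,
        ← enorm_neg]
      congr 1
      simp only [hg', real_inner_comm y d]
      ring
    simp_rw [hpt]
    rw [lintegral_const_mul _ (by fun_prop)]
    refine (mul_le_mul_right h _).trans ?_
    rw [← ENNReal.ofReal_mul (by positivity)]
    exact ENNReal.ofReal_le_ofReal (le_of_eq (by ring))
  refine (lintegral_mono hline).trans ?_
  rw [lintegral_lintegral_swap (by fun_prop)]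
  have hinner : ∀ t : ℝ, ∫⁻ z, ‖g' (x + t • d - z)‖ₑ = ∫⁻ y, ‖g' y‖ₑ := fun t =>
    lintegral_sub_left_eq_self (fun y => ‖g' y‖ₑ) (x + t • d)
  simpa [hinner] using hL1

/-- If `|φ| ≤ f̄` and `ξ > 0`, then `∇φ_ξ` is Lipschitz with constant
`f̄/ξ²`: for all `x, x'`, `‖∇φ_ξ(x) - ∇φ_ξ(x')‖ ≤ (f̄/ξ²) ‖x - x'‖`. -/
theorem stmt_6 (n : ℕ) (hn : 1 ≤ n) (fbar : ℝ) (hfbar : 0 ≤ fbar)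
    (φ : EuclideanSpace ℝ (Fin n) → ℝ) (hmeas : Measurable φ)
    (hbdd : ∀ z, |φ z| ≤ fbar) (ξ : ℝ) (hξ : 0 < ξ) :
    ∀ x x', ‖gradient (gaussSmooth n ξ φ) x - gradient (gaussSmooth n ξ φ) x'‖
      ≤ (fbar / ξ ^ 2) * ‖x - x'‖ := by
  intro x x'
  set w := gradient (gaussSmooth n ξ φ) x - gradient (gaussSmooth n ξ φ) x' with hw
  obtain ⟨hint, hinner⟩ := gradient_gaussSmooth_inner n hfbar hmeas hbdd hξ x w
  obtain ⟨hint', hinner'⟩ := gradient_gaussSmooth_inner n hfbar hmeas hbdd hξ x' w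
  have hsq : ‖w‖ ^ 2 = -∫ z, φ z * (inner ℝ w (x - z) * gaussKernel n ξ (x - z) / ξ ^ 2 -
      inner ℝ w (x' - z) * gaussKernel n ξ (x' - z) / ξ ^ 2) := by
    simp_rw [mul_sub]
    rw [integral_sub hint hint', ← real_inner_self_eq_norm_sq]
    nth_rewrite 1 [hw]
    rw [inner_sub_left, hinner, hinner']
    ring
  have hle : ‖w‖ ^ 2 ≤ fbar * (‖w‖ * ‖x - x'‖ / ξ ^ 2) := by
    rw [← ENNReal.ofReal_le_ofReal_iff (by positivity), ← Real.enorm_of_nonneg (sq_nonneg ‖w‖),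
      hsq, enorm_neg, ENNReal.ofReal_mul hfbar]
    refine (enorm_integral_le_lintegral_enorm _).trans ?_
    have h := lintegral_enorm_inner_mul_gaussKernel_sub_le n hξ w (x - x') x'
    rw [add_sub_cancel] at h
    refine le_trans ?_ (mul_le_mul_right h _)
    rw [← lintegral_const_mul' _ _ ENNReal.ofReal_ne_top]
    refine lintegral_mono fun z => ?_
    rw [enorm_mul]
    refine mul_le_mul_left ?_ _
    rw [← ofReal_norm]
    exact ENNReal.ofReal_le_ofReal (hbdd z)
  rcases (norm_nonneg w).eq_or_lt with h0 | hpos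
  · rw [← h0]; positivity
  · refine le_of_mul_le_mul_left ?_ hpos
    calc ‖w‖ * ‖w‖ = ‖w‖ ^ 2 := by ring
      _ ≤ _ := hle
      _ = _ := by ring
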